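/- arXiv:2010.14961 — 2 statements merged into one kernel-verified Lean document; each statement's English description precedes it below -/
import Mathlib

section
/- Let μ be a locally finite non-negative Borel measure on ℝ^d, x ∈ supp μ, and β ≥ 0. Suppose there exist ε > 0 and a sequence r_j → 0 with μ(B(x, r_j)) ≥ r_j^{β+ε} for all j. Then the tangent measure cone Tan(μ, x) is non-empty, i.e. there exist a non-zero locally finite measure ν, constants c_j > 0, and radii ρ_j ↓ 0 such that c_j · T_{x,ρ_j}[μ] converges weakly-* on compact sets to ν. -/
open MeasureTheory Metric Set Filter Topology

open scoped CompactlySupported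

section VagueCompactness

variable {X : Type*} [TopologicalSpace X] [MeasurableSpace X]

/-- A continuous function supported in a compact set `K` and bounded by `δ` has integral at most
`δ * ν K` in absolute value. -/
theorem abs_integral_le_of_tsupport_subset (ν : Measure X) [IsFiniteMeasureOnCompacts ν]
    {K : Set X} (hK : IsCompact K) {f : X → ℝ} (hf : tsupport f ⊆ K) {δ : ℝ}
    (hδ : ∀ y ∈ K, |f y| ≤ δ) : |∫ y, f y ∂ν| ≤ δ * ν.real K := by
  rw [← setIntegral_eq_integral_of_forall_compl_eq_zero (s := K)
    fun y hy => image_eq_zero_of_notMem_tsupport fun h => hy (hf h)]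
  exact norm_setIntegral_le_of_norm_le_const (f := f) hK.measure_lt_top hδ

variable [BorelSpace X] [LocallyCompactSpace X] [SecondCountableTopology X]

/-- A sequence of measures that is bounded on every compact set has a subsequence along which the
integrals of all compactly supported continuous functions converge. -/
theorem exists_subseq_tendsto_integral (ν : ℕ → Measure X)
    [∀ j, IsFiniteMeasureOnCompacts (ν j)]
    (hν : ∀ K, IsCompact K → BddAbove (range fun j => (ν j).real K)) :
    ∃ φ : ℕ → ℕ, StrictMono φ ∧ ∀ f : C(X, ℝ), HasCompactSupport f →
      ∃ l, Tendsto (fun j => ∫ y, f y ∂(ν (φ j))) atTop (𝓝 l) := by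
  let K := CompactExhaustion.choice X
  let S (n : ℕ) : Set C(X, ℝ) := {f | tsupport f ⊆ K n}
  have hD (n : ℕ) := TopologicalSpace.exists_countable_dense (S n)
  choose D hDc hDd using hD
  have (n : ℕ) : Countable (D n) := (hDc n).to_subtype
  choose B hB using fun n => hν (K n) (K.isCompact n)
  replace hB (n j : ℕ) : (ν j).real (K n) ≤ B n := hB n (mem_range_self j)
  have hbound (i : Σ n, D n) :
      ∃ C, ∀ j, ∫ y, i.2.1.1 y ∂(ν j) ∈ Icc (-C) C := by
    obtain ⟨n, ⟨f, hf⟩, hfD⟩ := i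
    obtain ⟨δ, hδ⟩ := (K.isCompact n).exists_bound_of_continuousOn f.continuous.continuousOn
    refine ⟨|δ| * B n, fun j => abs_le.1 ?_⟩
    refine (abs_integral_le_of_tsupport_subset (ν j) (K.isCompact n) hf
      fun y hy => (hδ y hy).trans (le_abs_self δ)).trans ?_
    exact mul_le_mul_of_nonneg_left (hB n j) (abs_nonneg δ)
  choose C hC using hbound
  obtain ⟨L, -, φ, hφ, hL⟩ := (isCompact_univ_pi fun i => isCompact_Icc (a := -C i) (b := C i)
    ).tendsto_subseq (x := fun j (i : Σ n, D n) => ∫ y, i.2.1.1 y ∂(ν j))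
    fun j i _ => hC i j
  rw [tendsto_pi_nhds] at hL
  refine ⟨φ, hφ, fun f hf => cauchySeq_tendsto_of_complete (Metric.cauchySeq_iff'.2 ?_)⟩
  intro ε hε
  obtain ⟨n, hn⟩ := K.exists_superset_of_isCompact hf.isCompact
  have hB0 : 0 ≤ B n := measureReal_nonneg.trans (hB n 0)
  set δ := ε / (4 * (B n + 1)) with hδ_def
  have hδ : 0 < δ := by positivity
  obtain ⟨g, hgD, hg⟩ : ∃ g ∈ D n, ∀ y ∈ K n, |f y - g.1 y| ≤ δ := by
    have hclose : ∀ᶠ g : S n in 𝓝 ⟨f, hn⟩,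
        ∀ y ∈ K n, dist (f y) (g.1 y) < δ :=
      Metric.tendstoUniformlyOn_iff.1
        (ContinuousMap.tendsto_iff_forall_isCompact_tendstoUniformlyOn.1
          (continuous_subtype_val.tendsto _) (K n) (K.isCompact n)) δ hδ
    obtain ⟨g, hg, hgD⟩ := mem_closure_iff_nhds.1 (hDd n ⟨f, hn⟩) _ hclose
    exact ⟨g, hgD, fun y hy => (hg y hy).le⟩
  have hgc : HasCompactSupport g.1 := (K.isCompact n).of_isClosed_subset isClosed_closure g.2
  have hfg (j : ℕ) : |∫ y, f y ∂(ν j) - ∫ y, g.1 y ∂(ν j)| ≤ ε / 4 := by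
    rw [← integral_sub (f.continuous.integrable_of_hasCompactSupport hf)
      (g.1.continuous.integrable_of_hasCompactSupport hgc)]
    have hsupp : tsupport (fun y => f y - g.1 y) ⊆ K n :=
      (tsupport_sub _ _).trans (union_subset hn g.2)
    calc _ ≤ δ * (ν j).real (K n) :=
          abs_integral_le_of_tsupport_subset (ν j) (K.isCompact n) hsupp hg
      _ ≤ δ * (B n + 1) := by gcongr; linarith [hB n j]
      _ = ε / 4 := by rw [hδ_def]; field_simp
  obtain ⟨N, hN⟩ := Metric.cauchySeq_iff'.1 (hL ⟨n, g, hgD⟩).cauchySeq (ε / 4) (by positivity)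
  refine ⟨N, fun j hj => ?_⟩
  have h₁ := abs_le.1 (hfg (φ j))
  have h₂ := abs_le.1 (hfg (φ N))
  have h₃ := abs_lt.1 (hN j hj)
  simp only [Function.comp_apply] at h₃
  rw [Real.dist_eq, abs_lt]
  constructor <;> linarith

/-- A sequence of measures that is bounded on every compact set has a vaguely convergent
subsequence. -/
theorem exists_subseq_tendsto_vaguely [T2Space X] (ν : ℕ → Measure X)
    [∀ j, IsFiniteMeasureOnCompacts (ν j)]
    (hν : ∀ K, IsCompact K → BddAbove (range fun j => (ν j).real K)) :
    ∃ (φ : ℕ → ℕ) (ν' : Measure X), StrictMono φ ∧ IsLocallyFiniteMeasure ν' ∧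
      ∀ f : C(X, ℝ), HasCompactSupport f →
        Tendsto (fun j => ∫ y, f y ∂(ν (φ j))) atTop (𝓝 (∫ y, f y ∂ν')) := by
  obtain ⟨φ, hφ, hlim⟩ := exists_subseq_tendsto_integral ν hν
  choose l hl using fun f : C_c(X, ℝ) => hlim f f.hasCompactSupport
  let Λ : C_c(X, ℝ) →ₚ[ℝ] ℝ := PositiveLinearMap.mk₀
    { toFun := l
      map_add' := fun f g => tendsto_nhds_unique (hl (f + g)) <| by
        refine ((hl f).add (hl g)).congr fun j => ?_
        exact (integral_add f.integrable g.integrable).symm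
      map_smul' := fun a f => tendsto_nhds_unique (hl (a • f)) <| by
        refine ((hl f).const_mul a).congr fun j => ?_
        exact (integral_const_mul a _).symm }
    fun f hf => ge_of_tendsto' (hl f) fun j => integral_nonneg fun y => hf y
  refine ⟨φ, RealRMK.rieszMeasure Λ, hφ, inferInstance, fun f hf => ?_⟩
  have h := RealRMK.integral_rieszMeasure Λ ⟨f, hf⟩
  have h' := hl ⟨f, hf⟩
  exact (congrArg 𝓝 h).symm ▸ h'

end VagueCompactness

/-- If a monotone function satisfies `M (r j) ≥ r j ^ s` along a sequence `r j → 0`, then there are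
arbitrarily small scales `ρ` above which `M` grows at most polynomially. -/
theorem exists_small_scale_polynomial_growth {M : ℝ → ℝ} (hM : Monotone M)
    (hpos : ∀ a, 0 < a → 0 < M a) {s : ℝ} (hs : 0 ≤ s) {r : ℕ → ℝ} (hr : ∀ j, 0 < r j)
    (hr0 : Tendsto r atTop (𝓝 0)) (hlow : ∀ j, r j ^ s ≤ M (r j)) {δ : ℝ} (hδ : 0 < δ) :
    ∃ ρ, 0 < ρ ∧ ρ < δ ∧
      ∀ R, 1 ≤ R → R * ρ ≤ 1 → M (R * ρ) ≤ 2 * R ^ (s + 1) * M ρ := by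
  have hM1 := hpos 1 one_pos
  have hη : 0 < min 1 (δ ^ (s + 1) / (2 * M 1)) := by positivity
  obtain ⟨j, hj⟩ := (hr0.eventually (gt_mem_nhds hη)).exists
  obtain ⟨hj1, hjδ⟩ := lt_min_iff.1 hj
  have hrj := hr j
  set a := r j
  let g : ℝ → ℝ := fun ρ => M ρ / ρ ^ (s + 1)
  have hbdd : BddAbove (g '' Icc a 1) := by
    refine ⟨M 1 / a ^ (s + 1), ?_⟩
    rintro _ ⟨ρ, ⟨h1, h2⟩, rfl⟩
    have := hM h2
    simp only [g]
    gcongr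
  have haI : a ∈ Icc a 1 := ⟨le_rfl, hj1.le⟩
  have hga : 0 < g a := div_pos (hpos a hrj) (by positivity)
  have hsup : 0 < sSup (g '' Icc a 1) := hga.trans_le (le_csSup hbdd (mem_image_of_mem g haI))
  obtain ⟨_, ⟨ρ, ⟨hρa, hρ1⟩, rfl⟩, hρ⟩ :=
    exists_lt_of_lt_csSup ⟨g a, mem_image_of_mem g haI⟩ (half_lt_self hsup)
  have hmax (ρ' : ℝ) (h : ρ' ∈ Icc a 1) : g ρ' ≤ 2 * g ρ := by
    linarith [le_csSup hbdd (mem_image_of_mem g h)]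
  have hρ0 : 0 < ρ := hrj.trans_le hρa
  refine ⟨ρ, hρ0, ?_, fun R hR hRρ => ?_⟩
  · by_contra! hle
    have hupper : g ρ ≤ M 1 / δ ^ (s + 1) := by
      have := hM hρ1
      simp only [g]
      gcongr
    have hlower : a⁻¹ ≤ g a := by
      simp only [g]
      rw [Real.rpow_add_one hrj.ne', le_div_iff₀ (by positivity)]
      calc _ = a ^ s := by field_simp
        _ ≤ M a := hlow j
    have h := hlower.trans ((hmax a haI).trans (mul_le_mul_of_nonneg_left hupper zero_le_two))
    rw [lt_div_iff₀ (by positivity)] at hjδ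
    rw [inv_le_iff_one_le_mul₀ hrj, ← mul_div_assoc, div_mul_eq_mul_div,
      le_div_iff₀ (by positivity)] at h
    linarith
  · have h := hmax (R * ρ) ⟨hρa.trans (le_mul_of_one_le_left hρ0.le hR), hRρ⟩
    simp only [g] at h
    rw [Real.mul_rpow (by positivity) hρ0.le, ← mul_div_assoc, div_le_div_iff₀ (by positivity)
      (by positivity)] at h
    have hp : 0 < ρ ^ (s + 1) := by positivity
    refine le_of_mul_le_mul_right ?_ hp
    linarith

/-- Lemma 2.6: if `μ` is locally finite, `x ∈ supp μ`, and `μ(B(x,r_j)) ≥ r_j^{β+ε}`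
along some sequence `r_j → 0`, then the tangent cone `Tan(μ,x)` is non-empty: there are
a non-zero locally finite measure `ν`, constants `c_j > 0` and radii `ρ_j ↓ 0` with
`c_j T_{x,ρ_j}[μ] → ν` weakly-* on compact sets. -/
theorem tangent_cone_nonempty
    (d : ℕ) (μ : Measure (EuclideanSpace ℝ (Fin d))) [IsLocallyFiniteMeasure μ]
    (x : EuclideanSpace ℝ (Fin d))
    (hx : ∀ r : ℝ, 0 < r → 0 < μ (closedBall x r))
    (β : ℝ) (hβ : 0 ≤ β) (ε : ℝ) (hε : 0 < ε)
    (r : ℕ → ℝ) (hrpos : ∀ j, 0 < r j) (hrlim : Tendsto r atTop (𝓝 0))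
    (hlow : ∀ j, ENNReal.ofReal (r j ^ (β + ε)) ≤ μ (closedBall x (r j))) :
    ∃ (ν : Measure (EuclideanSpace ℝ (Fin d))) (c ρ : ℕ → ℝ),
      IsLocallyFiniteMeasure ν ∧ ν ≠ 0 ∧
      (∀ j, 0 < c j) ∧ (∀ j, 0 < ρ j) ∧ Tendsto ρ atTop (𝓝 0) ∧
      ∀ f : C(EuclideanSpace ℝ (Fin d), ℝ), HasCompactSupport f →
        Tendsto (fun j => c j * ∫ z, f z ∂(μ.map (fun y => (ρ j)⁻¹ • (y - x))))
          atTop (𝓝 (∫ z, f z ∂ν)) := by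
  let M : ℝ → ℝ := fun a => μ.real (closedBall x a)
  have hfin (a : ℝ) : μ (closedBall x a) ≠ ⊤ := measure_closedBall_lt_top.ne
  have hmono : Monotone M := fun a b hab =>
    measureReal_mono (closedBall_subset_closedBall hab) (hfin b)
  have hpos (a : ℝ) (ha : 0 < a) : 0 < M a := ENNReal.toReal_pos (hx a ha).ne' (hfin a)
  have hlow' (j : ℕ) : r j ^ (β + ε) ≤ M (r j) :=
    (ENNReal.ofReal_le_iff_le_toReal (hfin _)).1 (hlow j)
  choose ρ hρ0 hρlt hρ using fun j : ℕ =>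
    exists_small_scale_polynomial_growth hmono hpos (by positivity) hrpos hrlim hlow'
      (Nat.one_div_pos_of_nat (α := ℝ) (n := j))
  have hρlim : Tendsto ρ atTop (𝓝 0) := squeeze_zero (fun j => (hρ0 j).le)
    (fun j => (hρlt j).le) tendsto_one_div_add_atTop_nhds_zero_nat
  let T (j : ℕ) : EuclideanSpace ℝ (Fin d) ≃ₜ EuclideanSpace ℝ (Fin d) :=
    (Homeomorph.subRight x).trans (Homeomorph.smulOfNeZero (ρ j)⁻¹ (inv_pos.2 (hρ0 j)).ne')
  have hc (j : ℕ) : 0 < (M (ρ j))⁻¹ := inv_pos.2 (hpos _ (hρ0 j))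
  let ν (j : ℕ) : Measure (EuclideanSpace ℝ (Fin d)) :=
    ENNReal.ofReal (M (ρ j))⁻¹ • μ.map (T j)
  have hνfin (j : ℕ) : IsFiniteMeasureOnCompacts (ν j) :=
    have := Measure.IsFiniteMeasureOnCompacts.map μ (T j)
    IsFiniteMeasureOnCompacts.smul _ ENNReal.ofReal_ne_top
  have hball (j : ℕ) (R : ℝ) : (ν j).real (closedBall 0 R) = (M (ρ j))⁻¹ * M (R * ρ j) := by
    have hpre : T j ⁻¹' closedBall 0 R = closedBall x (R * ρ j) := by
      ext y
      have : T j y = (ρ j)⁻¹ • (y - x) := rfl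
      rw [mem_preimage, mem_closedBall_zero_iff, mem_closedBall, this, norm_smul, norm_inv,
        Real.norm_of_nonneg (hρ0 j).le, dist_eq_norm, inv_mul_le_iff₀ (hρ0 j), mul_comm]
    rw [measureReal_ennreal_smul_apply, ENNReal.toReal_ofReal (hc j).le,
      map_measureReal_apply (T j).continuous.measurable measurableSet_closedBall, hpre]
  have hbdd (K : Set (EuclideanSpace ℝ (Fin d))) (hK : IsCompact K) :
      BddAbove (range fun j => (ν j).real K) := by
    obtain ⟨R₀, hR₀⟩ := hK.isBounded.subset_closedBall 0
    set R := max R₀ 1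
    have hR : 0 < R := lt_max_of_lt_right one_pos
    refine IsBoundedUnder.bddAbove_range ⟨2 * R ^ (β + ε + 1), ?_⟩
    rw [eventually_map]
    filter_upwards [hρlim.eventually (gt_mem_nhds (inv_pos.2 hR))] with j hj
    have hRρ : R * ρ j ≤ 1 := by
      rw [← mul_inv_cancel₀ hR.ne']
      gcongr
    calc (ν j).real K ≤ (ν j).real (closedBall 0 R) :=
          measureReal_mono (hR₀.trans (closedBall_subset_closedBall (le_max_left _ _)))
            (isCompact_closedBall 0 R).measure_lt_top.ne
      _ = (M (ρ j))⁻¹ * M (R * ρ j) := hball j R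
      _ ≤ 2 * R ^ (β + ε + 1) := by
          rw [inv_mul_le_iff₀ (hpos _ (hρ0 j)), mul_comm (M (ρ j))]
          exact hρ j R (le_max_right _ _) hRρ
  obtain ⟨φ, ν', hφ, hν', hlim⟩ := exists_subseq_tendsto_vaguely ν hbdd
  refine ⟨ν', fun j => (M (ρ (φ j)))⁻¹, fun j => ρ (φ j), hν', ?_, fun j => hc _, fun j => hρ0 _,
    hρlim.comp hφ.tendsto_atTop, fun f hf => (hlim f hf).congr fun j => ?_⟩
  · rintro rfl
    obtain ⟨f, hf1, -, hfc, hf01⟩ := exists_continuous_one_zero_of_isCompact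
      (isCompact_closedBall (0 : EuclideanSpace ℝ (Fin d)) 1) isClosed_empty (disjoint_empty _)
    have hge (j : ℕ) : 1 ≤ ∫ y, f y ∂(ν (φ j)) := by
      have hint := f.continuous.integrable_of_hasCompactSupport (μ := ν (φ j)) hfc
      calc (1 : ℝ) = (ν (φ j)).real (closedBall 0 1) := by
            rw [hball, one_mul, inv_mul_cancel₀ (hpos _ (hρ0 _)).ne']
        _ = ∫ y in closedBall 0 1, f y ∂(ν (φ j)) := by
            rw [setIntegral_congr_fun measurableSet_closedBall hf1]
            simp
        _ ≤ ∫ y, f y ∂(ν (φ j)) :=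
            setIntegral_le_integral hint (Eventually.of_forall fun y => (hf01 y).1)
    have := ge_of_tendsto' (hlim f hfc) hge
    rw [integral_zero_measure] at this
    linarith
  · rw [integral_smul_measure, ENNReal.toReal_ofReal (hc _).le]
    rfl
end

section
/- Let μ be a locally finite non-negative Borel measure on ℝ^d, x ∈ supp μ, β > 0, r₀ > 0, with μ(B(x,r)) ≤ r^β for all r ≤ r₀, and suppose for some ε > 0 there is a sequence r_j → 0 with μ(B(x,r_j)) ≥ r_j^{β+ε}. If ε is sufficiently small depending on β, then there exists a non-zero tangent measure ν ∈ Tan(μ,x) such that: (1) liminf_{ρ→0} log ν(B(0,ρ))/log ρ ≤ β + 2ε, and (2) ν(B(0,R)) ≤ R^{β+2ε} for all R > 1 (in particular ν is tempered). -/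
open MeasureTheory Metric Set Filter Topology

open scoped CompactlySupported

section VagueConvergence

variable {X : Type*} [TopologicalSpace X] [MeasurableSpace X]

/-- The integral of a function supported in a compact set is at most its sup norm times the mass of
that set. -/
lemma abs_integral_le_mul_measureReal_of_isCompact {m : Measure X} [IsFiniteMeasureOnCompacts m]
    {K : Set X} (hK : IsCompact K) {f : X → ℝ} (hf : ∀ z ∉ K, f z = 0) {a : ℝ}
    (ha : ∀ z ∈ K, |f z| ≤ a) : |∫ z, f z ∂m| ≤ a * m.real K := by
  rw [← setIntegral_eq_integral_of_forall_compl_eq_zero hf]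
  exact norm_setIntegral_le_of_norm_le_const (f := f) hK.measure_lt_top ha

lemma exists_tendsto_of_forall_approx {a : ℕ → ℝ}
    (h : ∀ δ > 0, ∃ b : ℕ → ℝ, (∃ l, Tendsto b atTop (𝓝 l)) ∧ ∀ᶠ j in atTop, |a j - b j| < δ) :
    ∃ l, Tendsto a atTop (𝓝 l) := by
  refine cauchySeq_tendsto_of_complete (Metric.cauchySeq_iff'.2 fun δ hδ => ?_)
  obtain ⟨b, ⟨l, hl⟩, hab⟩ := h (δ / 3) (by positivity)
  obtain ⟨M, hM⟩ := Metric.cauchySeq_iff'.1 hl.cauchySeq (δ / 6) (by positivity)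
  obtain ⟨N, hN⟩ := eventually_atTop.1 hab
  refine ⟨max M N, fun n hn => ?_⟩
  have h1 := hM n (le_of_max_le_left hn)
  have h2 := hM (max M N) (le_max_left _ _)
  have h3 := hN n (le_of_max_le_right hn)
  have h4 := hN (max M N) (le_max_right _ _)
  simp only [Real.dist_eq, abs_lt] at *
  constructor <;> linarith [h1.1, h1.2, h2.1, h2.2, h3.1, h3.2, h4.1, h4.2]

variable [BorelSpace X] [T2Space X] [LocallyCompactSpace X]

/-- A pointwise limit of the integrals against compactly supported functions is itself given by
integration against a locally finite measure. -/
lemma exists_measure_of_forall_tendsto_integral {m : ℕ → Measure X}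
    [∀ j, IsFiniteMeasureOnCompacts (m j)]
    (h : ∀ f : C_c(X, ℝ), ∃ l, Tendsto (fun j => ∫ z, f z ∂(m j)) atTop (𝓝 l)) :
    ∃ ν : Measure X, IsLocallyFiniteMeasure ν ∧
      ∀ f : C(X, ℝ), HasCompactSupport f →
        Tendsto (fun j => ∫ z, f z ∂(m j)) atTop (𝓝 (∫ z, f z ∂ν)) := by
  choose Λ hΛ using h
  have hg_int (g : C_c(X, ℝ)) (j : ℕ) : Integrable g (m j) :=
    g.continuous.integrable_of_hasCompactSupport g.hasCompactSupport
  let Λ' : C_c(X, ℝ) →ₚ[ℝ] ℝ :=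
  { toFun := Λ
    map_add' g g' := by
      refine tendsto_nhds_unique (hΛ (g + g')) (((hΛ g).add (hΛ g')).congr fun j => ?_)
      exact (integral_add (hg_int g j) (hg_int g' j)).symm
    map_smul' c g := by
      refine tendsto_nhds_unique (hΛ (c • g)) (((hΛ g).const_smul c).congr fun j => ?_)
      exact (integral_smul c _).symm
    monotone' g g' hgg' :=
      le_of_tendsto_of_tendsto' (hΛ g) (hΛ g') fun j =>
        integral_mono (hg_int g j) (hg_int g' j) hgg' }
  refine ⟨RealRMK.rieszMeasure Λ', inferInstance, fun f hf => ?_⟩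
  have := RealRMK.integral_rieszMeasure Λ' ⟨f, hf⟩
  exact this ▸ hΛ ⟨f, hf⟩

/-- The portmanteau theorem for vague convergence, on a compact set inside an open
one. -/
lemma measure_le_of_tendsto_integral {m : ℕ → Measure X} [∀ j, IsFiniteMeasureOnCompacts (m j)]
    {ν : Measure X} [IsFiniteMeasureOnCompacts ν]
    (h : ∀ f : C(X, ℝ), HasCompactSupport f →
      Tendsto (fun j => ∫ z, f z ∂(m j)) atTop (𝓝 (∫ z, f z ∂ν)))
    {K U : Set X} (hK : IsCompact K) (hU : IsOpen U) (hKU : K ⊆ U) {a : ENNReal} :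
    ((∀ᶠ j in atTop, m j U ≤ a) → ν K ≤ a) ∧ ((∃ᶠ j in atTop, a ≤ m j K) → a ≤ ν U) := by
  obtain ⟨f, hf1, hf0, hfc, hf⟩ := exists_continuous_one_zero_of_isCompact hK hU.isClosed_compl
    (disjoint_compl_right_iff_subset.2 hKU)
  have hlim := (ENNReal.continuous_ofReal.tendsto _).comp (h f hfc)
  have key (n : Measure X) [IsFiniteMeasureOnCompacts n] :
      n K ≤ ENNReal.ofReal (∫ z, f z ∂n) ∧ ENNReal.ofReal (∫ z, f z ∂n) ≤ n U := by
    rw [ofReal_integral_eq_lintegral_ofReal (f.continuous.integrable_of_hasCompactSupport hfc)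
      (ae_of_all _ fun z => (hf z).1)]
    constructor
    · rw [← lintegral_indicator_one hK.measurableSet]
      refine lintegral_mono (indicator_le fun z hz => ?_)
      simp [hf1 hz]
    · rw [← lintegral_indicator_one hU.measurableSet]
      refine lintegral_mono fun z => ?_
      by_cases hz : z ∈ U
      · simpa [hz] using (hf z).2
      · simp [hf0 hz]
  exact ⟨fun ha => (key ν).1.trans <| le_of_tendsto hlim <| ha.mono fun j hj => (key _).2.trans hj,
    fun ha => (ge_of_tendsto_of_frequently hlim <| ha.mono fun j hj => hj.trans (key _).1).trans
      (key ν).2⟩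

variable [SecondCountableTopology X]

/-- Vague sequential compactness: a sequence of measures which is eventually bounded on every
compact set has a vaguely convergent subsequence. -/
theorem exists_subseq_tendsto_integral_of_bounded_on_compacts {m : ℕ → Measure X}
    [∀ j, IsFiniteMeasureOnCompacts (m j)]
    (hm : ∀ K : Set X, IsCompact K → ∃ C : ℝ, ∀ᶠ j in atTop, (m j).real K ≤ C) :
    ∃ (ν : Measure X) (ψ : ℕ → ℕ), IsLocallyFiniteMeasure ν ∧ StrictMono ψ ∧
      ∀ f : C(X, ℝ), HasCompactSupport f →
        Tendsto (fun j => ∫ z, f z ∂(m (ψ j))) atTop (𝓝 (∫ z, f z ∂ν)) := by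
  let K : CompactExhaustion X := CompactExhaustion.choice X
  let S (n : ℕ) : Set C(X, ℝ) := {f | ∀ z ∉ K n, f z = 0}
  have (n : ℕ) : Nonempty (S n) := ⟨⟨0, fun _ _ => rfl⟩⟩
  let D (p : ℕ × ℕ) : C(X, ℝ) := TopologicalSpace.denseSeq (S p.1) p.2
  have hD (p : ℕ × ℕ) : ∀ z ∉ K p.1, D p z = 0 :=
    (TopologicalSpace.denseSeq (S p.1) p.2).2
  have hbdd (p : ℕ × ℕ) : ∃ B : ℝ, ∀ j, |∫ z, D p z ∂(m j)| ≤ B := by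
    obtain ⟨C, hC⟩ := hm (K p.1) (K.isCompact p.1)
    obtain ⟨a, ha⟩ := (K.isCompact p.1).exists_bound_of_continuousOn (D p).continuous.continuousOn
    obtain ⟨B, hB⟩ := (isBoundedUnder_of_eventually_le (f := atTop)
      (u := fun j => |∫ z, D p z ∂(m j)|) (a := |a| * C) (by
        filter_upwards [hC] with j hj
        refine (abs_integral_le_mul_measureReal_of_isCompact (K.isCompact p.1) (hD p)
          fun z hz => (ha z hz).trans (le_abs_self a)).trans ?_
        gcongr)).bddAbove_range
    exact ⟨B, fun j => hB (mem_range_self j)⟩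
  choose B hB using hbdd
  obtain ⟨l, -, ψ, hψ, hl⟩ := (isCompact_univ_pi fun p => isCompact_Icc (a := -B p) (b := B p))
    |>.tendsto_subseq (x := fun j p => ∫ z, D p z ∂(m j)) fun j p _ => abs_le.1 (hB p j)
  rw [tendsto_pi_nhds] at hl
  obtain ⟨ν, hν, hlim⟩ := exists_measure_of_forall_tendsto_integral
    (m := fun j => m (ψ j)) fun f => by
    refine exists_tendsto_of_forall_approx fun δ hδ => ?_
    obtain ⟨n, hn⟩ := K.exists_superset_of_isCompact f.hasCompactSupport.isCompact
    obtain ⟨C, hC⟩ := hm (K n) (K.isCompact n)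
    have hf : ∀ z ∉ K n, f z = 0 := fun z hz => image_eq_zero_of_notMem_tsupport fun h => hz (hn h)
    let η : ℝ := δ / (|C| + 1)
    have hη : 0 < η := by positivity
    have hopen : IsOpen {g : S n | MapsTo ((g : C(X, ℝ)) - f.toContinuousMap) (K n) (ball 0 η)} := by
      refine (ContinuousMap.isOpen_setOfPred_mapsTo (K.isCompact n) isOpen_ball).preimage
        (f := fun g : S n => (g : C(X, ℝ)) - f.toContinuousMap) ?_
      fun_prop
    obtain ⟨k, hk⟩ := (TopologicalSpace.denseRange_denseSeq (S n)).exists_mem_open hopen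
      ⟨⟨f.toContinuousMap, hf⟩, fun z _ => by simpa using hη⟩
    refine ⟨_, ⟨_, hl (n, k)⟩, ?_⟩
    filter_upwards [hψ.tendsto_atTop.eventually hC] with j hj
    have hfint : Integrable f (m (ψ j)) :=
      f.continuous.integrable_of_hasCompactSupport f.hasCompactSupport
    have hDint : Integrable (D (n, k)) (m (ψ j)) :=
      (D (n, k)).continuous.integrable_of_hasCompactSupport
        (HasCompactSupport.intro (K.isCompact n) fun z hz => hD (n, k) z hz)
    simp only [Function.comp_apply]
    rw [← integral_sub hfint hDint]
    calc _ ≤ η * (m (ψ j)).real (K n) := by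
          refine abs_integral_le_mul_measureReal_of_isCompact (K.isCompact n)
            (fun z hz => by simp [hf z hz, hD (n, k) z hz]) fun z hz => ?_
          have : |D (n, k) z - f z| < η := by simpa using hk hz
          rw [abs_sub_comm]
          exact this.le
      _ ≤ η * |C| := by gcongr; exact hj.trans (le_abs_self C)
      _ < η * (|C| + 1) := by gcongr; linarith
      _ = δ := by simp only [η]; field_simp
  exact ⟨ν, ψ, hν, hψ, hlim⟩

end VagueConvergence

/-- Scale selection for an antitone function `h` squeezed, along arbitrarily large arguments,
between lines of slopes `-(β + ε)` and `-β`. In terms of `k s = h s + (β + 2ε) s`, there are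
arbitrarily large `t` and a level `L` which `k` does not exceed before `t`, but which it reaches
again at many points of any given window after `t`. -/
lemma exists_scale_of_antitone {h : ℝ → ℝ} (hh : Antitone h) {β ε t₀ : ℝ} (hβ : 0 < β)
    (hε : 0 < ε) (ht₀ : 0 ≤ t₀) (hub : ∀ t, t₀ ≤ t → h t ≤ -β * t)
    (hlb : ∃ᶠ T in atTop, -(β + ε) * T ≤ h T) (V : ℝ) :
    ∃ t L, V ≤ t ∧ (∀ s ∈ Icc t₀ t, h s + (β + 2 * ε) * s ≤ L) ∧
      ∀ u ∈ Icc 1 V, ∃ v ∈ Icc (ε / (4 * (β + 2 * ε)) * u) u,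
        L ≤ h (t + v) + (β + 2 * ε) * (t + v) := by
  set γ := β + 2 * ε with hγ
  have hγ0 : 0 < γ := by positivity
  set k : ℝ → ℝ := fun s => h s + γ * s with hk
  let M : ℝ → ℝ := fun t => sSup (k '' Icc t₀ t)
  have hkub {s t : ℝ} (hs : s ∈ Icc t₀ t) : k s ≤ 2 * ε * t := by
    have h1 := hub s hs.1
    have h2 : 2 * ε * s ≤ 2 * ε * t := by gcongr; exact hs.2
    simp only [hk, hγ]
    nlinarith
  have hkM {s t : ℝ} (hs : s ∈ Icc t₀ t) : k s ≤ M t :=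
    le_csSup ⟨2 * ε * t, forall_mem_image.2 fun _ => hkub⟩ (mem_image_of_mem k hs)
  have hMle {t b : ℝ} (ht : t₀ ≤ t) (hb : ∀ s ∈ Icc t₀ t, k s ≤ b) : M t ≤ b :=
    csSup_le ((nonempty_Icc.2 ht).image k) (forall_mem_image.2 hb)
  have hslope {s t : ℝ} (hst : s ≤ t) : k t ≤ k s + γ * (t - s) := by
    have := hh hst
    simp only [hk]
    nlinarith
  have hMslope {s t : ℝ} (hs : t₀ ≤ s) (hst : s ≤ t) : M t ≤ M s + γ * (t - s) := by
    refine hMle (hs.trans hst) fun y hy => ?_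
    rcases le_total y s with hys | hys
    · have := hkM ⟨hy.1, hys⟩
      nlinarith
    · have h1 := hslope hys
      have h2 := hkM (right_mem_Icc.2 hs)
      have h3 : γ * (y - s) ≤ γ * (t - s) := by gcongr; exact hy.2
      linarith
  obtain ⟨T, hTh, hTt₀, hT1, hT2, hT3⟩ := (hlb.and_eventually
    ((eventually_ge_atTop t₀).and <| (eventually_ge_atTop (4 * k t₀ / ε)).and <|
      (eventually_ge_atTop (4 * γ * (|V| + 1) / ε)).and
        (eventually_ge_atTop (8 * (V + 1))))).exists
  rw [div_le_iff₀ hε] at hT1 hT2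
  have hMT : ε * T ≤ M T := by
    refine le_trans ?_ (hkM (right_mem_Icc.2 hTt₀))
    simp only [hk, hγ]
    nlinarith
  let S : Set ℝ := {t | t ∈ Icc t₀ T ∧ M t - ε / 2 * t ≤ ε / 4 * T}
  have hS₀ : t₀ ∈ S := by
    refine ⟨left_mem_Icc.2 hTt₀, ?_⟩
    have : M t₀ ≤ k t₀ := hMle le_rfl fun s hs => by rw [le_antisymm hs.2 hs.1]
    nlinarith
  obtain ⟨t, ⟨⟨htt₀, htT⟩, htM⟩, htS⟩ := exists_lt_of_lt_csSup ⟨t₀, hS₀⟩ (sub_one_lt (sSup S))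
  have hgap : |V| + 1 ≤ T - t := by
    have := hMslope htt₀ htT
    refine le_of_mul_le_mul_left ?_ hγ0
    nlinarith
  have hV := le_abs_self V
  have hafter {u : ℝ} (hu : 1 ≤ u) (huT : t + u ≤ T) : ε / 4 * T < M (t + u) - ε / 2 * (t + u) := by
    by_contra! hcon
    have : t + u ≤ sSup S := le_csSup ⟨T, fun s hs => hs.1.2⟩ ⟨⟨by linarith, huT⟩, hcon⟩
    linarith
  refine ⟨t, M t, ?_, fun s => hkM, fun u hu => ?_⟩
  · have h1 := hafter le_rfl (by linarith [abs_nonneg V])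
    have h2 : M (t + 1) ≤ 2 * ε * (t + 1) := hMle (by linarith) fun s => hkub
    have h3 : ε * T < ε * (8 * (t + 1)) := by nlinarith
    linarith [lt_of_mul_lt_mul_left h3 hε.le]
  · have h1 := hafter hu.1 (by linarith [hu.2])
    have h2 : M t + ε / 4 * u < M (t + u) := by nlinarith [hu.1]
    obtain ⟨_, ⟨s, hs, rfl⟩, hsM⟩ :=
      exists_lt_of_lt_csSup ((nonempty_Icc.2 (by linarith [hu.1])).image k) h2
    have hu0 : 0 < ε / 4 * u := by have := hu.1; positivity
    have hts : t ≤ s := by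
      by_contra! hcon
      have := hkM ⟨hs.1, hcon.le⟩
      linarith
    have h3 := hslope hts
    have h4 := hkM (right_mem_Icc.2 htt₀)
    refine ⟨s - t, ⟨?_, by linarith [hs.2]⟩, ?_⟩
    · refine le_of_mul_le_mul_left ?_ hγ0
      have : γ * (ε / (4 * γ) * u) = ε / 4 * u := by field_simp
      linarith
    · rw [add_sub_cancel]
      linarith

section Rescaling

variable {E : Type*} [NormedAddCommGroup E] [NormedSpace ℝ E] [MeasurableSpace E] [BorelSpace E]

lemma map_inv_smul_sub_closedBall (μ : Measure E) (x : E) {ρ : ℝ} (hρ : 0 < ρ) (R : ℝ) :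
    μ.map (fun y => ρ⁻¹ • (y - x)) (closedBall 0 R) = μ (closedBall x (ρ * R)) := by
  rw [Measure.map_apply (by fun_prop) measurableSet_closedBall]
  congr 1
  ext y
  simp [dist_eq_norm, norm_smul, abs_of_pos hρ, inv_mul_le_iff₀ hρ]

lemma isFiniteMeasureOnCompacts_map_inv_smul_sub [ProperSpace E] (μ : Measure E)
    [IsFiniteMeasureOnCompacts μ] (x : E) {ρ : ℝ} (hρ : 0 < ρ) :
    IsFiniteMeasureOnCompacts (μ.map (fun y => ρ⁻¹ • (y - x))) := by
  refine ⟨fun K hK => ?_⟩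
  obtain ⟨R, hR⟩ := hK.isBounded.subset_closedBall 0
  refine (measure_mono hR).trans_lt ?_
  rw [map_inv_smul_sub_closedBall μ x hρ]
  exact (isCompact_closedBall x _).measure_lt_top

end Rescaling

/-- If `ν (ball 0 (exp (-(v - 2)))) ≥ exp (-γ (v + 1))` for arbitrarily large `v`, then the lower
local dimension of `ν` at `0` is at most `γ`. -/
lemma liminf_log_measure_div_log_le {E : Type*} [NormedAddCommGroup E] [ProperSpace E]
    [MeasurableSpace E] {ν : Measure E} [IsFiniteMeasureOnCompacts ν] {γ : ℝ} (hγ : 0 ≤ γ)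
    (h : ∃ᶠ v in atTop, ENNReal.ofReal (Real.exp (-γ * (v + 1))) ≤
      ν (ball 0 (Real.exp (-(v - 2))))) :
    liminf (fun s : ℝ => Real.log (ν (closedBall 0 s)).toReal / Real.log s) (𝓝[>] 0) ≤ γ := by
  rw [liminf_eq]
  refine Real.sSup_le (fun a ha => ?_) hγ
  rw [mem_ofPred_eq] at ha
  by_contra! hγa
  have hexp : Tendsto (fun v : ℝ => Real.exp (-(v - 2))) atTop (𝓝[>] 0) :=
    Real.tendsto_exp_atBot_nhdsGT.comp
      (tendsto_neg_atTop_atBot.comp (tendsto_atTop_add_const_right _ (-2) tendsto_id))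
  obtain ⟨v, hv, hav, hv2, hvγ⟩ := (h.and_eventually ((hexp.eventually ha).and
    ((eventually_gt_atTop 2).and (eventually_gt_atTop ((2 * a + γ) / (a - γ)))))).exists
  rw [div_lt_iff₀ (sub_pos.2 hγa)] at hvγ
  set s := Real.exp (-(v - 2)) with hs
  have hfin : ν (closedBall 0 s) ≠ ⊤ := (isCompact_closedBall _ _).measure_lt_top.ne
  have hle : Real.exp (-γ * (v + 1)) ≤ (ν (closedBall 0 s)).toReal :=
    (ENNReal.ofReal_le_iff_le_toReal hfin).1 (hv.trans (measure_mono ball_subset_closedBall))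
  have hlog := Real.log_le_log (Real.exp_pos _) hle
  rw [Real.log_exp] at hlog
  rw [hs, Real.log_exp, ← hs, div_neg, le_neg, div_le_iff₀ (by linarith)] at hav
  nlinarith

/-- Proposition 2.2 (`TangentMeasureLocal`, classical part): if `μ(B(x,r)) ≤ r^β` for
`r ≤ r₀` but `μ(B(x,r_j)) ≥ r_j^{β+ε}` along a sequence `r_j → 0`, and `ε` is small
enough depending on `β`, then there is a non-zero tangent measure `ν ∈ Tan(μ,x)` with
`liminf_{ρ→0} log ν(B(0,ρ))/log ρ ≤ β + 2ε` and `ν(B(0,R)) ≤ R^{β+2ε}` for `R > 1`. -/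
theorem tangent_measure_local (d : ℕ) (β : ℝ) (hβ : 0 < β) :
    ∃ ε₀ : ℝ, 0 < ε₀ ∧
      ∀ (ε : ℝ), 0 < ε → ε < ε₀ →
      ∀ (μ : Measure (EuclideanSpace ℝ (Fin d))), IsLocallyFiniteMeasure μ →
      ∀ (x : EuclideanSpace ℝ (Fin d)),
        (∀ r : ℝ, 0 < r → 0 < μ (closedBall x r)) →
      ∀ (r₀ : ℝ), 0 < r₀ →
        (∀ r : ℝ, 0 < r → r ≤ r₀ → μ (closedBall x r) ≤ ENNReal.ofReal (r ^ β)) →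
      ∀ (r : ℕ → ℝ), (∀ j, 0 < r j) → Tendsto r atTop (𝓝 0) →
        (∀ j, ENNReal.ofReal (r j ^ (β + ε)) ≤ μ (closedBall x (r j))) →
      ∃ (ν : Measure (EuclideanSpace ℝ (Fin d))) (c ρ : ℕ → ℝ),
        IsLocallyFiniteMeasure ν ∧ ν ≠ 0 ∧
        (∀ j, 0 < c j) ∧ (∀ j, 0 < ρ j) ∧ Tendsto ρ atTop (𝓝 0) ∧
        (∀ f : C(EuclideanSpace ℝ (Fin d), ℝ), HasCompactSupport f →
          Tendsto (fun j => c j * ∫ z, f z ∂(μ.map (fun y => (ρ j)⁻¹ • (y - x))))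
            atTop (𝓝 (∫ z, f z ∂ν))) ∧
        (Filter.liminf
            (fun s : ℝ => Real.log (ν (closedBall 0 s)).toReal / Real.log s)
            (𝓝[>] 0) ≤ β + 2 * ε) ∧
        (∀ R : ℝ, 1 < R → ν (closedBall 0 R) ≤ ENNReal.ofReal (R ^ (β + 2 * ε))) := by
  refine ⟨1, one_pos, fun ε hε _ μ _ x hpos r₀ hr₀ hub r hr hr0 hlb => ?_⟩
  set γ := β + 2 * ε with hγ
  have hγ0 : 0 < γ := by positivity
  have hfin (s : ℝ) : μ (closedBall x s) ≠ ⊤ := (isCompact_closedBall x s).measure_lt_top.ne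
  have hreal {s : ℝ} (hs : 0 < s) : 0 < μ.real (closedBall x s) :=
    ENNReal.toReal_pos (hpos s hs).ne' (hfin s)
  let h : ℝ → ℝ := fun t => Real.log (μ.real (closedBall x (Real.exp (-t))))
  have hexp_h (t : ℝ) : ENNReal.ofReal (Real.exp (h t)) = μ (closedBall x (Real.exp (-t))) := by
    rw [Real.exp_log (hreal (Real.exp_pos _)), ofReal_measureReal (hfin _)]
  have hanti : Antitone h := fun s t hst =>
    Real.log_le_log (hreal (Real.exp_pos _)) <| measureReal_mono
      (closedBall_subset_closedBall (Real.exp_le_exp.2 (neg_le_neg hst))) (hfin _)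
  have hub' (t : ℝ) (ht : max 0 (-Real.log r₀) ≤ t) : h t ≤ -β * t := by
    have hle : Real.exp (-t) ≤ r₀ := by
      rw [← Real.exp_log hr₀]
      exact Real.exp_le_exp.2 (by linarith [le_of_max_le_right ht])
    have := ENNReal.toReal_le_of_le_ofReal (by positivity) (hub _ (Real.exp_pos _) hle)
    have := Real.log_le_log (hreal (Real.exp_pos _)) this
    rw [Real.log_rpow (Real.exp_pos _), Real.log_exp] at this
    linarith
  have hlb' : ∃ᶠ T in atTop, -(β + ε) * T ≤ h T := by
    have hlim : Tendsto (fun j => -Real.log (r j)) atTop atTop :=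
      tendsto_neg_atBot_atTop.comp <| Real.tendsto_log_nhdsGT_zero.comp <|
        tendsto_nhdsWithin_iff.2 ⟨hr0, Eventually.of_forall hr⟩
    refine hlim.frequently (Eventually.of_forall fun j => ?_).frequently
    have := (ENNReal.ofReal_le_iff_le_toReal (hfin _)).1 (hlb j)
    have := Real.log_le_log (Real.rpow_pos_of_pos (hr j) _) this
    rw [Real.log_rpow (hr j)] at this
    simp only [h, neg_neg, Real.exp_log (hr j), neg_mul_neg]
    exact this
  choose t L ht hbefore hafter using fun n : ℕ =>
    exists_scale_of_antitone hanti hβ hε (le_max_left 0 _) hub' hlb' n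
  rw [← hγ] at hafter
  let m (n : ℕ) : Measure (EuclideanSpace ℝ (Fin d)) :=
    ENNReal.ofReal (Real.exp (γ * t n - L n)) •
      μ.map (fun y => (Real.exp (-t n))⁻¹ • (y - x))
  have hm (n : ℕ) (u : ℝ) : m n (closedBall 0 (Real.exp u)) =
      ENNReal.ofReal (Real.exp (γ * t n - L n + h (t n - u))) := by
    rw [Measure.smul_apply, map_inv_smul_sub_closedBall μ x (Real.exp_pos _), Real.exp_add,
      ENNReal.ofReal_mul (Real.exp_pos _).le, hexp_h, ← Real.exp_add, smul_eq_mul, neg_sub,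
      sub_eq_add_neg u, add_comm u]
  have hmfin (n : ℕ) : IsFiniteMeasureOnCompacts (m n) := by
    have := isFiniteMeasureOnCompacts_map_inv_smul_sub μ x (Real.exp_pos (-t n))
    exact IsFiniteMeasureOnCompacts.smul _ ENNReal.ofReal_ne_top
  have htlim : Tendsto t atTop atTop := tendsto_atTop_mono ht tendsto_natCast_atTop_atTop
  have hm_le {u : ℝ} (hu : 0 ≤ u) :
      ∀ᶠ n in atTop, m n (closedBall 0 (Real.exp u)) ≤ ENNReal.ofReal (Real.exp (γ * u)) := by
    filter_upwards [htlim.eventually_ge_atTop (max 0 (-Real.log r₀) + u)] with n hn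
    rw [hm]
    gcongr
    have := hbefore n (t n - u) ⟨by linarith, by linarith⟩
    linarith
  obtain ⟨ν, ψ, hν, hψ, hlim⟩ := exists_subseq_tendsto_integral_of_bounded_on_compacts (m := m) (by
    intro K hK
    obtain ⟨R, hR⟩ := hK.isBounded.subset_closedBall 0
    refine ⟨Real.exp (γ * |R|), (hm_le (abs_nonneg R)).mono fun n hn => ?_⟩
    refine ENNReal.toReal_le_of_le_ofReal (Real.exp_pos _).le (le_trans (measure_mono ?_) hn)
    refine hR.trans (closedBall_subset_closedBall ?_)
    linarith [le_abs_self R, Real.add_one_le_exp |R|])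
  have hlower {u : ℝ} (hu : 1 ≤ u) : ∃ v, ε / (4 * γ) * u ≤ v ∧
      ENNReal.ofReal (Real.exp (-γ * (v + 1))) ≤ ν (ball 0 (Real.exp (-(v - 2)))) := by
    have hex (n : ℕ) : ∃ w, u ≤ ψ n → w ∈ Icc (ε / (4 * γ) * u) u ∧
        L (ψ n) ≤ h (t (ψ n) + w) + γ * (t (ψ n) + w) := by
      by_cases hn : u ≤ ψ n
      · obtain ⟨w, hw⟩ := hafter (ψ n) u ⟨hu, hn⟩
        exact ⟨w, fun _ => hw⟩
      · exact ⟨0, fun h => absurd h hn⟩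
    choose w hw using hex
    have hev : ∀ᶠ n in atTop, u ≤ ψ n :=
      (tendsto_natCast_atTop_atTop.comp hψ.tendsto_atTop).eventually_ge_atTop u
    obtain ⟨v, hv, hcluster⟩ := isCompact_Icc.exists_mapClusterPt_of_frequently (f := w)
      (hev.mono fun n hn => (hw n hn).1).frequently
    refine ⟨v, hv.1, (measure_le_of_tendsto_integral hlim (isCompact_closedBall 0
      (Real.exp (-(v - 1)))) isOpen_ball (closedBall_subset_ball
        (Real.exp_lt_exp.2 (by linarith)))).2 ?_⟩
    refine ((hcluster.frequently (Ioo_mem_nhds (sub_one_lt v) (lt_add_one v))).and_eventually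
      hev).mono fun n ⟨hwn, hn⟩ => ?_
    calc ENNReal.ofReal (Real.exp (-γ * (v + 1)))
        ≤ m (ψ n) (closedBall 0 (Real.exp (-w n))) := by
          rw [hm]
          have h1 := (hw n hn).2
          have h2 : γ * w n ≤ γ * (v + 1) := by gcongr; exact hwn.2.le
          gcongr
          rw [sub_neg_eq_add]
          linarith
      _ ≤ m (ψ n) (closedBall 0 (Real.exp (-(v - 1)))) := by
          gcongr
          exact hwn.1.le
  refine ⟨ν, fun n => Real.exp (γ * t (ψ n) - L (ψ n)), fun n => Real.exp (-t (ψ n)), hν, ?_,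
    fun _ => Real.exp_pos _, fun _ => Real.exp_pos _, ?_, fun f hf => ?_, ?_, fun R hR => ?_⟩
  · rintro rfl
    obtain ⟨v, -, hv⟩ := hlower le_rfl
    simp [(Real.exp_pos _).not_ge] at hv
  · exact Real.tendsto_exp_neg_atTop_nhds_zero.comp (htlim.comp hψ.tendsto_atTop)
  · simpa [m, integral_smul_measure, (Real.exp_pos _).le] using hlim f hf
  · refine liminf_log_measure_div_log_le hγ0.le (frequently_atTop.2 fun V => ?_)
    have hκ : 0 < ε / (4 * γ) := by positivity
    obtain ⟨v, hv, hle⟩ := hlower (le_max_left 1 (V / (ε / (4 * γ))))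
    refine ⟨v, le_trans ?_ hv, hle⟩
    rw [← div_le_iff₀' hκ]
    exact le_max_right _ _
  · have hR0 : 0 < R := one_pos.trans hR
    have hcont : Tendsto (fun R' : ℝ => ENNReal.ofReal (R' ^ γ)) (𝓝[>] R)
        (𝓝 (ENNReal.ofReal (R ^ γ))) :=
      (ENNReal.continuous_ofReal.tendsto _).comp
        ((Real.continuousAt_rpow_const R γ (Or.inl hR0.ne')).tendsto.mono_left nhdsWithin_le_nhds)
    refine ge_of_tendsto hcont (eventually_nhdsWithin_of_forall fun R' (hR' : R < R') => ?_)
    refine (measure_le_of_tendsto_integral hlim (isCompact_closedBall 0 R) isOpen_ball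
      (closedBall_subset_ball hR')).1 ?_
    have hR'0 : 0 < R' := hR0.trans hR'
    filter_upwards [hψ.tendsto_atTop.eventually
      (hm_le (Real.log_nonneg (hR.trans hR').le))] with n hn
    rw [Real.exp_log hR'0, mul_comm, ← Real.rpow_def_of_pos hR'0] at hn
    exact (measure_mono ball_subset_closedBall).trans hn
end
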